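/- arXiv:1007.0583 — 2 statements merged into one kernel-verified Lean document; each statement's English description precedes it below -/
import Mathlib

section
/- Let Σ ⊆ CAT(Λ_s^ℤ) be a maximal commutative semigroup. Then Σ₊ = Σ ∩ CAT(Λ_s^ℕ) is maximal commutative in CAT(Λ_s^ℕ). -/
/-- The left shift on one-sided sequences over the alphabet `A`. -/
def shiftN (A : Type) : (ℕ → A) → (ℕ → A) := fun a k => a (k + 1)

/-- A cellular automaton transformation of the one-sided full shift over `A`. -/
def IsCAT (A : Type) [TopologicalSpace A] (τ : (ℕ → A) → (ℕ → A)) : Prop :=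
  Continuous τ ∧ τ ∘ shiftN A = shiftN A ∘ τ

/-- The semigroup `CAT(Λ^ℕ)` of all one-sided cellular automaton transformations. -/
def CATset (A : Type) [TopologicalSpace A] : Set ((ℕ → A) → (ℕ → A)) := {τ | IsCAT A τ}

/-- The left shift on two-sided sequences over the alphabet `A`. -/
def shiftZ (A : Type) : (ℤ → A) → (ℤ → A) := fun a k => a (k + 1)

/-- A cellular automaton transformation of the two-sided full shift over `A`. -/
def IsCATZ (A : Type) [TopologicalSpace A] (τ : (ℤ → A) → (ℤ → A)) : Prop :=
  Continuous τ ∧ τ ∘ shiftZ A = shiftZ A ∘ τ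

/-- The semigroup `CAT(Λ^ℤ)` of all two-sided cellular automaton transformations. -/
def CATZset (A : Type) [TopologicalSpace A] : Set ((ℤ → A) → (ℤ → A)) := {τ | IsCATZ A τ}

/-- The canonical extension of a one-sided cellular automaton transformation to the
two-sided shift space (same block map); realizes `CAT(Λ^ℕ) ⊆ CAT(Λ^ℤ)`. -/
def extendZ (A : Type) (τ : (ℕ → A) → (ℕ → A)) : (ℤ → A) → (ℤ → A) :=
  fun a k => τ (fun n => a (k + n)) 0

/-- `S` is a maximal commutative subsemigroup of `CAT`. -/
def IsMC {Ω : Type} (CAT S : Set (Ω → Ω)) : Prop :=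
  S ⊆ CAT ∧ (∀ τ ∈ S, ∀ μ ∈ S, τ ∘ μ = μ ∘ τ) ∧
    ∀ μ ∈ CAT, (∀ τ ∈ S, μ ∘ τ = τ ∘ μ) → μ ∈ S

/-- Translation by an arbitrary integer on two-sided sequences. -/
def translateZ (A : Type) (m : ℤ) : (ℤ → A) → (ℤ → A) := fun x k => x (k + m)

lemma translateZ_translateZ {A : Type} (m n : ℤ) (x : ℤ → A) :
    translateZ A m (translateZ A n x) = translateZ A (m + n) x := by
  funext k
  simp only [translateZ, add_assoc]

lemma translateZ_zero {A : Type} (x : ℤ → A) : translateZ A 0 x = x := by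
  funext k
  simp [translateZ]

lemma translateZ_injective {A : Type} (m : ℤ) : Function.Injective (translateZ A m) := by
  refine Function.LeftInverse.injective (g := translateZ A (-m)) fun x => ?_
  rw [translateZ_translateZ, neg_add_cancel, translateZ_zero]

section

variable {A : Type} [TopologicalSpace A]

lemma IsCAT.map_translate {τ : (ℕ → A) → (ℕ → A)} (hτ : IsCAT A τ) (a : ℕ → A) (m : ℕ) :
    τ (fun k => a (k + m)) = fun k => τ a (k + m) := by
  induction m with
  | zero => rfl
  | succ m ih =>
    have h := congrFun hτ.2 (fun k => a (k + m))
    simp only [Function.comp_apply, ih] at h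
    have e : shiftN A (fun k => a (k + m)) = fun k => a (k + (m + 1)) := by
      funext k
      simp only [shiftN]
      congr 1
      omega
    rw [e] at h
    rw [h]
    funext k
    simp only [shiftN]
    congr 1
    omega

lemma IsCATZ.map_translateZ_natCast {μ : (ℤ → A) → (ℤ → A)} (hμ : IsCATZ A μ) (x : ℤ → A)
    (m : ℕ) : μ (translateZ A m x) = translateZ A m (μ x) := by
  have hiter (y : ℤ → A) : translateZ A (m : ℤ) y = (shiftZ A)^[m] y := by
    induction m generalizing y with
    | zero => funext k; simp [translateZ]
    | succ m ih =>
      rw [Function.iterate_succ_apply, ← ih]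
      funext k
      simp only [translateZ, shiftZ]
      congr 1
      push_cast
      ring
  rw [hiter, hiter]
  exact (Function.Commute.iterate_right (f := μ) (g := shiftZ A) (fun y => congrFun hμ.2 y) m) x

lemma IsCATZ.map_translateZ {μ : (ℤ → A) → (ℤ → A)} (hμ : IsCATZ A μ) (m : ℤ) (x : ℤ → A) :
    μ (translateZ A m x) = translateZ A m (μ x) := by
  obtain ⟨n, rfl | rfl⟩ := m.eq_nat_or_neg
  · exact hμ.map_translateZ_natCast x n
  · apply translateZ_injective (n : ℤ)
    rw [← hμ.map_translateZ_natCast, translateZ_translateZ, translateZ_translateZ,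
      add_neg_cancel, translateZ_zero, translateZ_zero]

lemma isCATZ_translateZ (m : ℤ) : IsCATZ A (translateZ A m) := by
  refine ⟨by unfold translateZ; fun_prop, ?_⟩
  funext x k
  simp only [translateZ, shiftZ, Function.comp_apply]
  congr 1
  ring

lemma IsCATZ.comp {μ ν : (ℤ → A) → (ℤ → A)} (hμ : IsCATZ A μ) (hν : IsCATZ A ν) :
    IsCATZ A (μ ∘ ν) := by
  refine ⟨hμ.1.comp hν.1, ?_⟩
  rw [Function.comp_assoc, hν.2, ← Function.comp_assoc, hμ.2, Function.comp_assoc]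

lemma IsCAT.isCATZ_extendZ {τ : (ℕ → A) → (ℕ → A)} (hτ : IsCAT A τ) :
    IsCATZ A (extendZ A τ) := by
  constructor
  · refine continuous_pi fun k => ?_
    have hc : Continuous fun x : ℤ → A => fun n : ℕ => x (k + n) := by fun_prop
    exact (continuous_apply 0).comp (hτ.1.comp hc)
  · funext x k
    simp only [extendZ, shiftZ, Function.comp_apply]
    congr 2
    funext n
    congr 1
    ring

lemma extendZ_comp (τ : (ℕ → A) → (ℕ → A)) {ν : (ℕ → A) → (ℕ → A)} (hν : IsCAT A ν) :
    extendZ A (τ ∘ ν) = extendZ A τ ∘ extendZ A ν := by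
  funext x k
  simp only [extendZ, Function.comp_apply]
  congr 2
  funext n
  have h := congrFun (hν.map_translate (fun i : ℕ => x (k + i)) n) 0
  simp only [zero_add] at h
  rw [← h]
  congr 2
  funext i
  congr 1
  push_cast
  ring

lemma IsCAT.apply_eq_extendZ {τ : (ℕ → A) → (ℕ → A)} (hτ : IsCAT A τ) (a : ℕ → A) (k : ℕ) :
    τ a k = extendZ A τ (fun j => a j.toNat) k := by
  have h := congrFun (hτ.map_translate a k) 0
  simp only [zero_add] at h
  rw [← h, extendZ]
  congr 2
  funext n
  congr 1
  omega

lemma IsCAT.comp {τ ν : (ℕ → A) → (ℕ → A)} (hτ : IsCAT A τ) (hν : IsCAT A ν) :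
    IsCAT A (τ ∘ ν) := by
  refine ⟨hτ.1.comp hν.1, ?_⟩
  rw [Function.comp_assoc, hν.2, ← Function.comp_assoc, hτ.2, Function.comp_assoc]

lemma extendZ_injOn : Set.InjOn (extendZ A) (CATset A) := by
  intro τ hτ ν hν h
  funext a k
  rw [IsCAT.apply_eq_extendZ hτ, IsCAT.apply_eq_extendZ hν, h]

/-- A continuous map from a full shift over a compact alphabet to a discrete space does not
depend on coordinates far to the left. -/
lemma exists_window_of_continuous {B : Type} [TopologicalSpace B] [DiscreteTopology B]
    [CompactSpace A] {f : (ℤ → A) → B} (hf : Continuous f) :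
    ∃ n : ℕ, ∀ x y : ℤ → A, (∀ j : ℤ, -n ≤ j → x j = y j) → f x = f y := by
  have hcell (z : ℤ → A) : ∃ (I : Finset ℤ) (u : ℤ → Set A),
      (∀ i ∈ I, IsOpen (u i) ∧ z i ∈ u i) ∧ (I : Set ℤ).pi u ⊆ f ⁻¹' {f z} :=
    isOpen_pi_iff.1 ((isOpen_discrete {f z}).preimage hf) z rfl
  choose I u hu hsub using hcell
  obtain ⟨t, ht⟩ := isCompact_univ.elim_finite_subcover
    (fun z : ℤ → A => (I z : Set ℤ).pi (u z))
    (fun z => isOpen_set_pi (I z).finite_toSet fun i hi => (hu z i hi).1)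
    (fun z _ => Set.mem_iUnion.2 ⟨z, fun i hi => (hu z i hi).2⟩)
  refine ⟨t.sup fun z => (I z).sup Int.natAbs, fun x y hxy => ?_⟩
  obtain ⟨z, hzt, hxz⟩ := Set.mem_iUnion₂.1 (ht (Set.mem_univ x))
  have hyz : y ∈ (I z : Set ℤ).pi (u z) := by
    intro i hi
    have h1 : i.natAbs ≤ (I z).sup Int.natAbs := Finset.le_sup (f := Int.natAbs) hi
    have h2 : (I z).sup Int.natAbs ≤ t.sup fun z => (I z).sup Int.natAbs :=
      Finset.le_sup (f := fun z => (I z).sup Int.natAbs) hzt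
    rw [← hxy i (by omega)]
    exact hxz i hi
  exact (hsub z hxz).trans (hsub z hyz).symm

/-- Every two-sided cellular automaton becomes one-sided after a large enough translation. -/
lemma IsCATZ.exists_extendZ_eq [CompactSpace A] [DiscreteTopology A]
    {μ : (ℤ → A) → (ℤ → A)} (hμ : IsCATZ A μ) :
    ∃ (n : ℕ) (ν : (ℕ → A) → (ℕ → A)), IsCAT A ν ∧ extendZ A ν = translateZ A n ∘ μ := by
  obtain ⟨n, hn⟩ := exists_window_of_continuous ((continuous_apply (0 : ℤ)).comp hμ.1)
  refine ⟨n, fun a k => μ (fun j => a ((j + n).toNat + k)) 0, ⟨?_, ?_⟩, ?_⟩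
  · refine continuous_pi fun k => ?_
    have hc : Continuous fun a : ℕ → A => fun j : ℤ => a ((j + n).toNat + k) := by fun_prop
    exact (continuous_apply 0).comp (hμ.1.comp hc)
  · rfl
  · funext x k
    have h1 : translateZ A n (μ x) k = μ (translateZ A (k + n) x) 0 := by
      rw [hμ.map_translateZ]
      simp [translateZ]
    rw [Function.comp_apply, h1]
    refine hn _ _ fun j hj => ?_
    simp only [translateZ]
    congr 1
    push_cast
    omega

end

/-- If `Σ ⊆ CAT(Λ_s^ℤ)` is maximal commutative, then
`Σ₊ = Σ ∩ CAT(Λ_s^ℕ)` (the one-sided transformations belonging to `Σ`) is maximal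
commutative in `CAT(Λ_s^ℕ)`. -/
theorem twoSided_MC_to_oneSided_MC (s : ℕ) (hs : 2 ≤ s)
    (S : Set ((ℤ → Fin s) → (ℤ → Fin s))) (hMC : IsMC (CATZset (Fin s)) S) :
    IsMC (CATset (Fin s))
      {τ : (ℕ → Fin s) → (ℕ → Fin s) | IsCAT (Fin s) τ ∧ extendZ (Fin s) τ ∈ S} := by
  obtain ⟨hsub, hcomm, hmax⟩ := hMC
  refine ⟨fun τ hτ => hτ.1, ?_, ?_⟩
  · rintro τ ⟨hτ, hτS⟩ ν ⟨hν, hνS⟩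
    apply extendZ_injOn (hτ.comp hν) (hν.comp hτ)
    rw [extendZ_comp τ hν, extendZ_comp ν hτ]
    exact hcomm _ hτS _ hνS
  · intro τ hτ hτcomm
    refine ⟨hτ, hmax _ (IsCAT.isCATZ_extendZ hτ) fun μ hμS => ?_⟩
    have hμ : IsCATZ (Fin s) μ := hsub hμS
    obtain ⟨n, ν, hν, hνμ⟩ := hμ.exists_extendZ_eq
    have hνS : extendZ (Fin s) ν ∈ S := by
      rw [hνμ]
      refine hmax _ ((isCATZ_translateZ _).comp hμ) fun κ hκS => ?_
      funext x
      have hκ : IsCATZ (Fin s) κ := hsub hκS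
      have h := congrFun (hcomm μ hμS κ hκS) x
      simp only [Function.comp_apply] at h ⊢
      rw [hκ.map_translateZ, h]
    have hext : extendZ (Fin s) τ ∘ extendZ (Fin s) ν =
        extendZ (Fin s) ν ∘ extendZ (Fin s) τ := by
      rw [← extendZ_comp τ hν, ← extendZ_comp ν hτ, hτcomm ν ⟨hν, hνS⟩]
    funext x
    apply translateZ_injective (n : ℤ)
    have h := congrFun hext x
    simp only [hνμ, Function.comp_apply] at h ⊢
    rw [← (IsCAT.isCATZ_extendZ hτ).map_translateZ, h]
end

section
/- Let p be a prime dividing s with s not a power of p. Then the semigroup ⟨μ_p, σ, σ^{−1}⟩ ⊆ CAT(Λ_s^ℤ) is an ID semigroup. Consequently, if s is not a power of a prime, the automorphism group Aut(Λ_s^ℤ) of bijective cellular automaton transformations of the two-sided shift is an ID semigroup. -/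
/-- The inverse shift `σ⁻¹` on two-sided sequences. -/
def invShiftZ (A : Type) : (ℤ → A) → (ℤ → A) := fun a k => a (k - 1)

/-- The multiplication-by-`p` cellular automaton transformation on `Λ_s^ℤ`:
`μ_p(a)_k = (p·a_k + ⌊p·a_{k+1}/s⌋) mod s`. -/
def muPZ (s p : ℕ) : (ℤ → Fin s) → (ℤ → Fin s) := fun a k =>
  if h : 0 < s then ⟨(p * (a k).val + p * (a (k + 1)).val / s) % s, Nat.mod_lt _ h⟩
  else a k

/-- Membership in the semigroup generated (under composition) by a set of transformations. -/
inductive InGen {Ω : Type} (S : Set (Ω → Ω)) : (Ω → Ω) → Prop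
  | base {τ : Ω → Ω} : τ ∈ S → InGen S τ
  | comp {τ μ : Ω → Ω} : InGen S τ → InGen S μ → InGen S (τ ∘ μ)

/-- The semigroup generated (under composition) by a set of transformations. -/
def gen {Ω : Type} (S : Set (Ω → Ω)) : Set (Ω → Ω) := {τ | InGen S τ}

/-- A family of transformations of a space `Ω` has the ID ("Infinite is Dense") property
if every closed invariant proper subset of `Ω` is finite. -/
def HasID {Ω : Type} [TopologicalSpace Ω] (S : Set (Ω → Ω)) : Prop :=
  ∀ A : Set Ω, IsClosed A → (∀ τ ∈ S, ∀ x ∈ A, τ x ∈ A) → A ≠ Set.univ → A.Finite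

section Furstenberg

open Filter Topology Pointwise

/-- Nonnegative integer combinations of two rationally independent positive reals are
eventually arbitrarily dense on the half-line. -/
theorem exists_nat_combination_near {α β : ℝ} (hβ : 0 < β)
    (h : Irrational (α / β)) {η : ℝ} (hη : 0 < η) :
    ∃ T : ℝ, ∀ t ≥ T, ∃ m n : ℕ, m * α + n * β ≤ t ∧ t < m * α + n * β + η := by
  have hd := dense_addSubgroupClosure_pair_iff.2 h
  obtain ⟨d, hd, hd0, hdη⟩ := hd.exists_between hη
  obtain ⟨u, v, rfl⟩ := AddSubgroup.mem_closure_pair.1 hd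
  simp only [zsmul_eq_mul] at hd0 hdη
  set d : ℝ := u * α + v * β with hddef
  obtain ⟨L, hL⟩ := exists_nat_ge (β / d)
  set K : ℕ := L * (u.natAbs + v.natAbs) with hK
  refine ⟨K * (α + β), fun t ht => ?_⟩
  set t' := t - K * (α + β) with ht'
  have ht0 : 0 ≤ t' := by linarith
  set n0 := ⌊t' / β⌋₊ with hn0
  have h1 : n0 * β ≤ t' := (le_div_iff₀ hβ).1 (Nat.floor_le (by positivity))
  have h2 : t' < (n0 + 1) * β := (div_lt_iff₀ hβ).1 (Nat.lt_floor_add_one _)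
  set r := t' - n0 * β with hr
  have hr0 : 0 ≤ r := by linarith
  have hrβ : r < β := by linarith
  set i := ⌊r / d⌋₊ with hi
  have h3 : i * d ≤ r := (le_div_iff₀ hd0).1 (Nat.floor_le (by positivity))
  have h4 : r < (i + 1) * d := (div_lt_iff₀ hd0).1 (Nat.lt_floor_add_one _)
  have hiL : i ≤ L := by
    have : (i : ℝ) ≤ L := by
      refine le_trans ?_ hL
      rw [le_div_iff₀ hd0]; linarith
    exact_mod_cast this
  have hu : 0 ≤ (i : ℤ) * u + K := by
    have : (i : ℤ) * |u| ≤ L * (|u| + |v|) := by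
      have := abs_nonneg v
      have := abs_nonneg u
      have : (i : ℤ) ≤ L := by exact_mod_cast hiL
      gcongr; linarith
    have h5 : (i : ℤ) * (-u) ≤ i * |u| := by gcongr; exact neg_le_abs u
    rw [hK]; push_cast; linarith
  have hv : 0 ≤ (i : ℤ) * v + n0 + K := by
    have : (i : ℤ) * |v| ≤ L * (|u| + |v|) := by
      have := abs_nonneg v
      have := abs_nonneg u
      have : (i : ℤ) ≤ L := by exact_mod_cast hiL
      gcongr; linarith
    have h5 : (i : ℤ) * (-v) ≤ i * |v| := by gcongr; exact neg_le_abs v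
    rw [hK]; push_cast; linarith
  obtain ⟨m, hm⟩ := Int.eq_ofNat_of_zero_le hu
  obtain ⟨n, hn⟩ := Int.eq_ofNat_of_zero_le hv
  have hm' : (m : ℝ) = i * u + K := by exact_mod_cast hm.symm
  have hn' : (n : ℝ) = i * v + n0 + K := by exact_mod_cast hn.symm
  have key : m * α + n * β = t - r + i * d := by
    rw [hm', hn', hr, ht', hddef]; ring
  exact ⟨m, n, by rw [key]; linarith, by rw [key]; linarith⟩

/-- Multiplying a small positive real by suitable products `p ^ m * q ^ n` brings it close to any
prescribed positive real. -/
theorem exists_pow_mul_pow_mul_near {p q : ℕ} (hp : 1 < p) (hq : 1 < q)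
    (h : Irrational (Real.log p / Real.log q)) {y ε : ℝ} (hy : 0 < y) (hε : 0 < ε) :
    ∃ δ > 0, ∀ x : ℝ, 0 < x → x < δ →
      ∃ m n : ℕ, |((p ^ m * q ^ n : ℕ) : ℝ) * x - y| < ε := by
  have hp' : (1 : ℝ) < p := by exact_mod_cast hp
  have hq' : (1 : ℝ) < q := by exact_mod_cast hq
  obtain ⟨T, hT⟩ := exists_nat_combination_near (Real.log_pos hq') h
    (div_pos hε hy)
  refine ⟨y * Real.exp (-T), by positivity, fun x hx hxδ => ?_⟩
  have hlog : Real.log x ≤ Real.log y - T := by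
    have := Real.log_le_log hx hxδ.le
    rwa [Real.log_mul hy.ne' (Real.exp_pos _).ne', Real.log_exp] at this
  obtain ⟨m, n, h1, h2⟩ := hT (Real.log y - Real.log x) (by linarith)
  refine ⟨m, n, ?_⟩
  set θ := Real.log y - Real.log x - (m * Real.log p + n * Real.log q) with hθ
  have hval : ((p ^ m * q ^ n : ℕ) : ℝ) * x = y * Real.exp (-θ) := by
    have hpos : 0 < ((p ^ m * q ^ n : ℕ) : ℝ) * x := by positivity
    refine Real.log_injOn_pos hpos (Set.mem_Ioi.2 (mul_pos hy (Real.exp_pos (-θ)))) ?_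
    rw [Real.log_mul hy.ne' (Real.exp_pos _).ne', Real.log_exp,
      Real.log_mul (by positivity) hx.ne']
    push_cast
    rw [Real.log_mul (by positivity) (by positivity), Real.log_pow, Real.log_pow, hθ]
    ring
  have hexp := Real.add_one_le_exp (-θ)
  have hexp1 : Real.exp (-θ) ≤ 1 := Real.exp_le_one_iff.2 (by linarith)
  have hθε : θ * y < ε := by
    rw [← lt_div_iff₀ hy]; linarith
  rw [hval, abs_lt]
  constructor <;> nlinarith

/-- A point of the circle lifts to a real of absolute value its norm. -/
theorem UnitAddCircle.exists_coe_eq_abs_eq_norm (x : UnitAddCircle) :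
    ∃ r : ℝ, (r : UnitAddCircle) = x ∧ |r| = ‖x‖ := by
  obtain ⟨r, rfl⟩ := QuotientAddGroup.mk_surjective x
  refine ⟨r - round r, ?_, (UnitAddCircle.norm_eq).symm⟩
  have : ((round r : ℝ) : UnitAddCircle) = 0 := by
    rw [AddCircle.coe_eq_zero_iff]; exact ⟨round r, by simp⟩
  rw [AddCircle.coe_sub, this, sub_zero]

theorem UnitAddCircle.norm_coe_le_abs (r : ℝ) : ‖(r : UnitAddCircle)‖ ≤ |r| := by
  rw [UnitAddCircle.norm_eq]
  simpa using round_le r 0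

/-- A set invariant under multiplication by `p` and `q` is invariant under `p ^ m * q ^ n`. -/
theorem pow_mul_pow_nsmul_mem {G : Type*} [AddMonoid G] {A : Set G} {p q : ℕ}
    (hpA : ∀ x ∈ A, p • x ∈ A) (hqA : ∀ x ∈ A, q • x ∈ A) (m n : ℕ) {x : G} (hx : x ∈ A) :
    (p ^ m * q ^ n) • x ∈ A := by
  induction m with
  | zero =>
    induction n with
    | zero => simpa
    | succ n ih => rw [pow_succ, ← mul_assoc, mul_nsmul]; exact hqA _ ih
  | succ m ih =>
    rw [show p ^ (m + 1) * q ^ n = (p ^ m * q ^ n) * p by ring, mul_nsmul]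
    exact hpA _ ih

/-- A closed `p, q`-invariant subset of the circle accumulating at zero is everything. -/
theorem eq_univ_of_accumulates_zero {p q : ℕ} (hp : 1 < p) (hq : 1 < q)
    (h : Irrational (Real.log p / Real.log q)) {A : Set UnitAddCircle} (hA : IsClosed A)
    (hpA : ∀ x ∈ A, p • x ∈ A) (hqA : ∀ x ∈ A, q • x ∈ A)
    (h0 : ∀ δ > 0, ∃ x ∈ A, x ≠ 0 ∧ ‖x‖ < δ) : A = Set.univ := by
  refine Set.eq_univ_of_forall fun y => ?_
  rw [← hA.closure_eq, Metric.mem_closure_iff]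
  intro ε hε
  obtain ⟨r, rfl, hr⟩ := UnitAddCircle.exists_coe_eq_abs_eq_norm y
  have hone : ((1 : ℝ) : UnitAddCircle) = 0 := AddCircle.coe_period 1
  have hr1 : |r| < 1 := by
    have := AddCircle.norm_le_half_period (1 : ℝ) (x := (r : UnitAddCircle)) one_ne_zero
    rw [hr]; norm_num at this; linarith
  rw [abs_lt] at hr1
  obtain ⟨δ₁, hδ₁, H₁⟩ := exists_pow_mul_pow_mul_near hp hq h (y := 1 + r) (by linarith) hε
  obtain ⟨δ₂, hδ₂, H₂⟩ := exists_pow_mul_pow_mul_near hp hq h (y := 1 - r) (by linarith) hε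
  obtain ⟨x, hxA, hx0, hxδ⟩ := h0 (min δ₁ δ₂) (lt_min hδ₁ hδ₂)
  obtain ⟨z, rfl, hz⟩ := UnitAddCircle.exists_coe_eq_abs_eq_norm x
  rw [← hz, lt_min_iff] at hxδ
  have hz0 : z ≠ 0 := by rintro rfl; exact hx0 (by simp)
  rcases lt_or_gt_of_ne hz0 with hneg | hpos
  · obtain ⟨m, n, hmn⟩ := H₂ (-z) (by linarith) (by rw [← abs_of_neg hneg]; exact hxδ.2)
    refine ⟨_, pow_mul_pow_nsmul_mem hpA hqA m n hxA, ?_⟩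
    have : (r : UnitAddCircle) - (p ^ m * q ^ n) • (z : UnitAddCircle) =
        (((p ^ m * q ^ n : ℕ) : ℝ) * (-z) - (1 - r) : ℝ) := by
      rw [← AddCircle.coe_nsmul, ← AddCircle.coe_sub, nsmul_eq_mul,
        ← sub_zero ((r - _ : ℝ) : UnitAddCircle), ← hone, ← AddCircle.coe_sub]
      congr 1; ring
    rw [dist_eq_norm, this]
    exact (UnitAddCircle.norm_coe_le_abs _).trans_lt hmn
  · obtain ⟨m, n, hmn⟩ := H₁ z hpos (by rw [← abs_of_pos hpos]; exact hxδ.1)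
    refine ⟨_, pow_mul_pow_nsmul_mem hpA hqA m n hxA, ?_⟩
    have : (p ^ m * q ^ n) • (z : UnitAddCircle) - (r : UnitAddCircle) =
        (((p ^ m * q ^ n : ℕ) : ℝ) * z - (1 + r) : ℝ) := by
      rw [← AddCircle.coe_nsmul, ← AddCircle.coe_sub, nsmul_eq_mul,
        ← sub_zero ((_ - r : ℝ) : UnitAddCircle), ← hone, ← AddCircle.coe_sub]
      congr 1; ring
    rw [dist_comm, dist_eq_norm, this]
    exact (UnitAddCircle.norm_coe_le_abs _).trans_lt hmn

/-- A nonempty finite set invariant under multiplication by `p > 1` contains a torsion point. -/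
theorem exists_isOfFinAddOrder_of_finite {G : Type*} [AddGroup G] {B : Set G} (hB : B.Finite)
    (hne : B.Nonempty) {p : ℕ} (hp : 1 < p) (hpB : ∀ x ∈ B, p • x ∈ B) :
    ∃ x ∈ B, IsOfFinAddOrder x := by
  obtain ⟨x, hx⟩ := hne
  have hmem : ∀ k : ℕ, p ^ k • x ∈ B := fun k => by
    simpa using pow_mul_pow_nsmul_mem hpB hpB k 0 hx
  obtain ⟨i, -, j, -, hij, he⟩ := Set.infinite_univ.exists_ne_map_eq_of_mapsTo
    (f := fun k : ℕ => p ^ k • x) (fun k _ => hmem k) hB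
  refine ⟨x, hx, ?_⟩
  by_contra hfin
  exact hij (Nat.pow_right_injective hp (injective_nsmul_iff_not_isOfFinAddOrder.2 hfin he))

/-- Multiplication by a positive integer preserves accumulation points on the circle. -/
theorem nsmul_mem_derivedSet {A : Set UnitAddCircle} {n : ℕ} (hn : 0 < n)
    (hA : ∀ x ∈ A, n • x ∈ A) : ∀ x ∈ derivedSet A, n • x ∈ derivedSet A := by
  intro x hx
  rw [mem_derivedSet, accPt_iff_frequently] at hx ⊢
  have hfin : {u : UnitAddCircle | n • u = 0}.Finite := AddCircle.finite_torsion 1 hn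
  have hcl : IsClosed ({u : UnitAddCircle | n • u = 0} \ {0}) := (hfin.subset Set.sdiff_subset).isClosed
  have hnear : ∀ᶠ y in 𝓝 x, y - x ∉ {u : UnitAddCircle | n • u = 0} \ {0} := by
    have hc : Tendsto (fun y : UnitAddCircle => y - x) (𝓝 x) (𝓝 0) := by
      have : Continuous (fun y : UnitAddCircle => y - x) := by fun_prop
      simpa using this.tendsto x
    exact hc.eventually (hcl.isOpen_compl.mem_nhds (by simp))
  have hc : Tendsto (fun y : UnitAddCircle => n • y) (𝓝 x) (𝓝 (n • x)) :=
    (continuous_nsmul n).tendsto x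
  refine hc.frequently ((hx.and_eventually hnear).mono ?_)
  rintro y ⟨⟨hyx, hyA⟩, hy⟩
  refine ⟨fun he => hy ⟨?_, ?_⟩, hA y hyA⟩
  · simp [nsmul_sub, he]
  · simpa [sub_eq_zero] using hyx

/-- The difference set of an infinite subset of the circle accumulates at zero. -/
theorem exists_sub_norm_lt_of_infinite {B : Set UnitAddCircle} (hB : B.Infinite) {δ : ℝ}
    (hδ : 0 < δ) : ∃ x ∈ B, ∃ y ∈ B, x - y ≠ 0 ∧ ‖x - y‖ < δ := by
  obtain ⟨z, hz⟩ := hB.exists_accPt_principal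
  rw [accPt_iff_frequently] at hz
  obtain ⟨x, ⟨hxz, hxB⟩, hx⟩ :=
    (hz.and_eventually (Metric.ball_mem_nhds z (half_pos hδ))).exists
  have hball : Metric.ball z (min (δ / 2) (dist x z)) ∈ 𝓝 z :=
    Metric.ball_mem_nhds z (lt_min (half_pos hδ) (dist_pos.2 hxz))
  obtain ⟨y, ⟨-, hyB⟩, hy⟩ := (hz.and_eventually hball).exists
  have hy' := lt_min_iff.1 hy
  refine ⟨x, hxB, y, hyB, ?_, ?_⟩
  · rw [sub_ne_zero]
    rintro rfl
    exact lt_irrefl _ hy'.2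
  · rw [← dist_eq_norm]
    have := dist_triangle_right x y z
    linarith [hy'.1]

/-- If `t • c = 0` and `p` is coprime to `t` then `p ^ φ(t)` fixes `c`. -/
theorem pow_totient_nsmul_eq_self {G : Type*} [AddGroup G] {c : G} {t p : ℕ} (hc : t • c = 0)
    (hpt : p.Coprime t) : p ^ t.totient • c = c := by
  have h1 : p ^ t.totient ≡ 1 [MOD addOrderOf c] :=
    (Nat.ModEq.pow_totient hpt).of_dvd (addOrderOf_dvd_iff_nsmul_eq_zero.2 hc)
  simpa using nsmul_eq_nsmul_iff_modEq.2 h1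

/-- The logarithm ratio is unchanged when both numbers are raised to the same power. -/
theorem irrational_log_pow_div_log_pow {p q u : ℕ} (hu : 0 < u)
    (h : Irrational (Real.log p / Real.log q)) :
    Irrational (Real.log (p ^ u : ℕ) / Real.log (q ^ u : ℕ)) := by
  have hu' : (u : ℝ) ≠ 0 := by positivity
  push_cast
  rwa [Real.log_pow, Real.log_pow, mul_div_mul_left _ _ hu']

/-- A closed `p, q`-invariant subset of the circle with an accumulation point of finite order is
everything. -/
theorem eq_univ_of_torsion_mem_derivedSet {p q : ℕ} (hp : 1 < p) (hq : 1 < q)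
    (h : Irrational (Real.log p / Real.log q)) {A : Set UnitAddCircle} (hA : IsClosed A)
    (hpA : ∀ x ∈ A, p • x ∈ A) (hqA : ∀ x ∈ A, q • x ∈ A) {r : UnitAddCircle}
    (hr : r ∈ derivedSet A) (hfin : IsOfFinAddOrder r) : A = Set.univ := by
  have hpq : 1 < p * q := by nlinarith
  have hmem : ∀ k : ℕ, (p * q) ^ k • r ∈ derivedSet A := fun k => by
    rw [mul_pow]
    exact pow_mul_pow_nsmul_mem (nsmul_mem_derivedSet (by lia) hpA)
      (nsmul_mem_derivedSet (by lia) hqA) k k hr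
  obtain ⟨i, j, hij, he⟩ : ∃ i j : ℕ, i < j ∧ (p * q) ^ i • r = (p * q) ^ j • r := by
    have hf : (AddSubmonoid.multiples r : Set UnitAddCircle).Finite :=
      finite_multiples.2 hfin
    obtain ⟨i, -, j, -, hij, he⟩ := Set.infinite_univ.exists_ne_map_eq_of_mapsTo
      (f := fun k : ℕ => (p * q) ^ k • r)
      (fun k _ => (AddSubmonoid.mem_multiples_iff _ _).2 ⟨_, rfl⟩) hf
    rcases lt_or_gt_of_ne hij with h | h
    exacts [⟨i, j, h, he⟩, ⟨j, i, h, he.symm⟩]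
  obtain ⟨l, rfl⟩ := Nat.exists_eq_add_of_lt hij
  set c := (p * q) ^ i • r with hc
  have hcA : c ∈ derivedSet A := hmem i
  obtain ⟨t, ht⟩ : ∃ t, (p * q) ^ (l + 1) = t + 1 := Nat.exists_eq_add_one.2 (by positivity)
  have htc : t • c = 0 := by
    have h1 : (p * q) ^ (l + 1) • c = c := by
      rw [hc, ← mul_nsmul', ← pow_add, show l + 1 + i = i + l + 1 by ring, ← he]
    rw [ht, succ_nsmul] at h1
    simpa using h1
  have ht0 : 0 < t := by
    have := Nat.one_lt_pow (n := l + 1) (by lia) hpq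
    lia
  have hcop : ((p * q) ^ (l + 1)).Coprime t := by rw [ht]; simp
  have hu := Nat.totient_pos.2 ht0
  have hpc := pow_totient_nsmul_eq_self htc (hcop.coprime_dvd_left
    ((dvd_mul_right p q).trans (dvd_pow_self _ (by simp))))
  have hqc := pow_totient_nsmul_eq_self htc (hcop.coprime_dvd_left
    ((dvd_mul_left q p).trans (dvd_pow_self _ (by simp))))
  set u := t.totient
  have hpow : ∀ n : ℕ, (∀ x ∈ A, n • x ∈ A) → n ^ u • c = c →
      ∀ x ∈ (fun x => x + c) ⁻¹' A, n ^ u • x ∈ (fun x => x + c) ⁻¹' A := by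
    intro n hn hnc x hx
    have := pow_mul_pow_nsmul_mem hn hn u 0 (Set.mem_preimage.1 hx)
    rwa [pow_zero, mul_one, nsmul_add, hnc] at this
  have huniv : (fun x => x + c) ⁻¹' A = Set.univ := by
    refine eq_univ_of_accumulates_zero (Nat.one_lt_pow hu.ne' hp) (Nat.one_lt_pow hu.ne' hq)
      (irrational_log_pow_div_log_pow hu h) (hA.preimage (by fun_prop))
      (hpow p hpA hpc) (hpow q hqA hqc) fun δ hδ => ?_
    rw [mem_derivedSet, accPt_iff_frequently] at hcA
    obtain ⟨x, ⟨hxc, hxA⟩, hx⟩ := (hcA.and_eventually (Metric.ball_mem_nhds c hδ)).exists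
    exact ⟨x - c, by simpa using hxA, sub_ne_zero.2 hxc, by rwa [← dist_eq_norm]⟩
  refine Set.eq_univ_of_forall fun y => ?_
  have : y - c ∈ (fun x => x + c) ⁻¹' A := huniv ▸ Set.mem_univ _
  simpa using this

/-- A nonempty closed `p, q`-invariant subset of the circle contains a torsion point. -/
theorem exists_isOfFinAddOrder_of_isClosed {p q : ℕ} (hp : 1 < p) (hq : 1 < q)
    (h : Irrational (Real.log p / Real.log q)) {X : Set UnitAddCircle} (hX : IsClosed X)
    (hpX : ∀ x ∈ X, p • x ∈ X) (hqX : ∀ x ∈ X, q • x ∈ X) (hne : X.Nonempty) :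
    ∃ x ∈ X, IsOfFinAddOrder x := by
  by_contra! hno
  refine hno 0 ?_ IsOfFinAddOrder.zero
  rw [← hX.closure_eq, Metric.mem_closure_iff]
  intro ε hε
  obtain ⟨k, hk⟩ := exists_nat_gt (1 / ε)
  set t := p * q * k + 1 with ht
  have ht0 : 0 < t := by lia
  have hkt : (k : ℝ) ≤ t := by
    have : k ≤ t := by
      have : 0 < p * q := by positivity
      nlinarith
    exact_mod_cast this
  have htR : (0 : ℝ) < t := by exact_mod_cast ht0
  set c : UnitAddCircle := ((1 / t : ℝ) : UnitAddCircle) with hc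
  have htc : t • c = 0 := by
    rw [hc, ← AddCircle.coe_nsmul, nsmul_eq_mul, mul_one_div_cancel htR.ne']
    exact AddCircle.coe_period 1
  have hu := Nat.totient_pos.2 ht0
  have hpc : p ^ t.totient • c = c := pow_totient_nsmul_eq_self htc (by
    rw [ht, mul_assoc]; simp)
  have hqc : q ^ t.totient • c = c := pow_totient_nsmul_eq_self htc (by
    rw [ht, mul_comm p q, mul_assoc]; simp)
  set u := t.totient
  set B : ℕ → Set UnitAddCircle := fun j => {x | ∀ i ≤ j, x + i • c ∈ X} with hB
  have hBX : ∀ j, B j ⊆ X := fun j x hx => by simpa using hx 0 (Nat.zero_le j)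
  have hBclosed : ∀ j, IsClosed (B j) := fun j => by
    simp only [hB, Set.ofPred_forall]
    exact isClosed_iInter fun i => isClosed_iInter fun _ => hX.preimage (by fun_prop)
  have hBinv : ∀ n : ℕ, (∀ x ∈ X, n • x ∈ X) → n ^ u • c = c →
      ∀ j, ∀ x ∈ B j, n ^ u • x ∈ B j := by
    intro n hn hnc j x hx i hi
    have := pow_mul_pow_nsmul_mem hn hn u 0 (hx i hi)
    rwa [pow_zero, mul_one, nsmul_add, nsmul_left_comm, hnc] at this
  have hpu : 1 < p ^ u := Nat.one_lt_pow hu.ne' hp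
  have hqu : 1 < q ^ u := Nat.one_lt_pow hu.ne' hq
  have hBne : ∀ j, (B j).Nonempty := by
    intro j
    induction j with
    | zero =>
      obtain ⟨x, hx⟩ := hne
      exact ⟨x, fun i hi => by simpa [Nat.le_zero.1 hi] using hx⟩
    | succ j ih =>
      have hinf : (B j).Infinite := fun hfin => by
        obtain ⟨x, hx, hx'⟩ := exists_isOfFinAddOrder_of_finite hfin ih hpu (hBinv p hpX hpc j)
        exact hno x (hBX j hx) hx'
      have hsub : ∀ n : ℕ, (∀ x ∈ B j, n • x ∈ B j) → ∀ x ∈ B j - B j, n • x ∈ B j - B j := by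
        rintro n hn _ ⟨x, hx, y, hy, rfl⟩
        exact ⟨n • x, hn x hx, n • y, hn y hy, (nsmul_sub x y n).symm⟩
      have huniv : B j - B j = Set.univ := by
        refine eq_univ_of_accumulates_zero hpu hqu (irrational_log_pow_div_log_pow hu h)
          (sub_eq_add_neg (B j) (B j) ▸
            ((hBclosed j).isCompact.add (hBclosed j).isCompact.neg).isClosed)
          (hsub _ (hBinv p hpX hpc j)) (hsub _ (hBinv q hqX hqc j)) fun δ hδ => ?_
        obtain ⟨x, hx, y, hy, hxy, hlt⟩ := exists_sub_norm_lt_of_infinite hinf hδ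
        exact ⟨x - y, Set.sub_mem_sub hx hy, hxy, hlt⟩
      obtain ⟨y, hy, x, hx, hyx⟩ : c ∈ B j - B j := huniv ▸ Set.mem_univ c
      refine ⟨x, fun i hi => ?_⟩
      rcases i with _ | i
      · simpa using hBX j hx
      · have := hy i (by lia)
        rw [← sub_add_cancel y x, show y - x = c from hyx] at this
        rwa [succ_nsmul', ← add_assoc, add_comm x c]
  obtain ⟨x, hx⟩ := hBne t
  obtain ⟨r, hr, hr0, hr1⟩ : ∃ r : ℝ, (r : UnitAddCircle) = -x ∧ 0 ≤ r ∧ r < 1 := by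
    obtain ⟨r, hr⟩ := QuotientAddGroup.mk_surjective (-x)
    refine ⟨Int.fract r, ?_, Int.fract_nonneg r, Int.fract_lt_one r⟩
    have : ((⌊r⌋ : ℝ) : UnitAddCircle) = 0 := by
      rw [AddCircle.coe_eq_zero_iff]; exact ⟨⌊r⌋, by simp⟩
    rw [Int.fract, AddCircle.coe_sub, this, sub_zero]
    exact hr
  set i := ⌊r * t⌋₊ with hi
  have h1 : (i : ℝ) ≤ r * t := Nat.floor_le (by positivity)
  have h2 : r * t < i + 1 := Nat.lt_floor_add_one _
  have hit : i ≤ t := by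
    have : (i : ℝ) ≤ t := h1.trans (by nlinarith)
    exact_mod_cast this
  refine ⟨x + i • c, hx i hit, ?_⟩
  have hdiff : 0 - (x + i • c) = ((r - i * (1 / t) : ℝ) : UnitAddCircle) := by
    rw [AddCircle.coe_sub, hr, ← nsmul_eq_mul, AddCircle.coe_nsmul]
    abel
  rw [dist_eq_norm, hdiff]
  refine (UnitAddCircle.norm_coe_le_abs _).trans_lt ?_
  have hεt : 1 < ε * t := by
    rw [div_lt_iff₀ hε] at hk
    nlinarith
  rw [show r - i * (1 / t) = (r * t - i) / t by field_simp, abs_div, abs_of_pos htR,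
    div_lt_iff₀ htR, abs_lt]
  constructor <;> linarith

/-- **Furstenberg's theorem**: a closed subset of the circle invariant under multiplication by two
multiplicatively independent integers is finite or everything. -/
theorem finite_or_eq_univ_of_nsmul_invariant {p q : ℕ} (hp : 1 < p) (hq : 1 < q)
    (h : Irrational (Real.log p / Real.log q)) {A : Set UnitAddCircle} (hA : IsClosed A)
    (hpA : ∀ x ∈ A, p • x ∈ A) (hqA : ∀ x ∈ A, q • x ∈ A) : A.Finite ∨ A = Set.univ := by
  refine or_iff_not_imp_left.2 fun hinf => ?_
  obtain ⟨z, hz⟩ := Set.Infinite.exists_accPt_principal hinf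
  obtain ⟨r, hr, hfin⟩ := exists_isOfFinAddOrder_of_isClosed hp hq h (isClosed_derivedSet A)
    (nsmul_mem_derivedSet (by lia) hpA) (nsmul_mem_derivedSet (by lia) hqA) ⟨z, hz⟩
  exact eq_univ_of_torsion_mem_derivedSet hp hq h hA hpA hqA hr hfin

end Furstenberg

/-- A prime `p` and a number that is not a power of `p` are multiplicatively independent. -/
theorem irrational_log_div_log_of_not_pow {s p : ℕ} (hs : 2 ≤ s) (hp : p.Prime)
    (hpow : ¬ ∃ m : ℕ, s = p ^ m) : Irrational (Real.log p / Real.log s) := by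
  rintro ⟨r, hr⟩
  have hlp : 0 < Real.log p := Real.log_pos (by exact_mod_cast hp.one_lt)
  have hls : 0 < Real.log s := Real.log_pos (by exact_mod_cast hs)
  have hr0 : 0 < r := by
    have : (0 : ℝ) < r := by rw [hr]; positivity
    exact_mod_cast this
  obtain ⟨n, hn⟩ := Int.eq_ofNat_of_zero_le (Rat.num_nonneg.2 hr0.le)
  have hn0 : n ≠ 0 := by
    rintro rfl
    have := Rat.num_pos.2 hr0
    simp_all
  have hden : (0 : ℝ) < r.den := by exact_mod_cast r.pos
  have hlog : r.den * Real.log p = n * Real.log s := by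
    rw [Rat.cast_def, hn, div_eq_div_iff hden.ne' hls.ne'] at hr
    simpa [mul_comm] using hr.symm
  rw [← Real.log_pow, ← Real.log_pow] at hlog
  have hp0 : (0 : ℝ) < p := by exact_mod_cast hp.pos
  have hs0 : (0 : ℝ) < s := by positivity
  have heq : p ^ r.den = s ^ n := by
    exact_mod_cast Real.log_injOn_pos (Set.mem_Ioi.2 (pow_pos hp0 _))
      (Set.mem_Ioi.2 (pow_pos hs0 _)) hlog
  obtain ⟨k, -, hk⟩ := (Nat.dvd_prime_pow hp).1 (heq ▸ dvd_pow_self s hn0 : s ∣ p ^ r.den)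
  exact hpow ⟨k, hk⟩

/-- Splitting off the leading digit of an expansion in base `s`. -/
theorem mul_ofDigits_eq {s : ℕ} (x : ℕ → Fin s) :
    s * Real.ofDigits x = x 0 + Real.ofDigits (fun n => x (n + 1)) := by
  have hs : (s : ℝ) ≠ 0 := by exact_mod_cast (Fin.pos (x 0)).ne'
  rw [Real.ofDigits_eq_sum_add_ofDigits x 1]
  simp [Real.ofDigitsTerm]
  field_simp

theorem ofDigits_pos_of_digit_pos {s : ℕ} {x : ℕ → Fin s} {k : ℕ} (hk : 0 < (x k).val) :
    0 < Real.ofDigits x := by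
  have hs : (0 : ℝ) < s := by exact_mod_cast Fin.pos (x 0)
  have hk' : (0 : ℝ) < (x k).val := by exact_mod_cast hk
  refine Real.summable_ofDigitsTerm.tsum_pos (fun _ => Real.ofDigitsTerm_nonneg) k ?_
  simp only [Real.ofDigitsTerm]
  positivity

theorem ofDigits_lt_one_of_digit_lt {s : ℕ} {k : ℕ} : ∀ {x : ℕ → Fin s}, (x k).val + 1 < s →
    Real.ofDigits x < 1 := by
  induction k with
  | zero =>
    intro x hx
    have h := mul_ofDigits_eq x
    have h1 := Real.ofDigits_le_one (fun n => x (n + 1))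
    have hx' : ((x 0).val : ℝ) + 1 < s := by exact_mod_cast hx
    have := Real.ofDigits_nonneg x
    nlinarith
  | succ k ih =>
    intro x hx
    have h := mul_ofDigits_eq x
    have h1 := ih (x := fun n => x (n + 1)) hx
    have hx' : ((x 0).val : ℝ) + 1 ≤ s := by exact_mod_cast (x 0).isLt
    have := Real.ofDigits_nonneg x
    nlinarith

/-- Two expansions of equal value coincide if the second has infinitely many nonzero and
infinitely many nonmaximal digits. -/
theorem eq_of_ofDigits_eq {s : ℕ} {x y : ℕ → Fin s} (h : Real.ofDigits x = Real.ofDigits y)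
    (hy0 : ∀ n, ∃ k ≥ n, 0 < (y k).val) (hy1 : ∀ n, ∃ k ≥ n, (y k).val + 1 < s) : x = y := by
  have htail : ∀ n, Real.ofDigits (fun k => x (k + n)) = Real.ofDigits (fun k => y (k + n)) ∧
      (∀ k < n, x k = y k) := by
    intro n
    induction n with
    | zero => simpa using h
    | succ n ih =>
      have hx := mul_ofDigits_eq (fun k => x (k + n))
      have hy := mul_ofDigits_eq (fun k => y (k + n))
      simp only [Nat.zero_add, Nat.add_right_comm _ 1 n] at hx hy
      rw [ih.1, hy] at hx
      obtain ⟨k₀, hk₀, h₀⟩ := hy0 (n + 1)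
      obtain ⟨k₁, hk₁, h₁⟩ := hy1 (n + 1)
      have hpos : 0 < Real.ofDigits (fun k => y (k + n + 1)) :=
        ofDigits_pos_of_digit_pos (k := k₀ - (n + 1))
          (by rwa [show k₀ - (n + 1) + n + 1 = k₀ by lia])
      have hlt : Real.ofDigits (fun k => y (k + n + 1)) < 1 :=
        ofDigits_lt_one_of_digit_lt (k := k₁ - (n + 1))
          (by rwa [show k₁ - (n + 1) + n + 1 = k₁ by lia])
      have h0 := Real.ofDigits_nonneg (fun k => x (k + n + 1))
      have h1 := Real.ofDigits_le_one (fun k => x (k + n + 1))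
      have hxy : (x n).val = (y n).val := by
        have hle : ((x n).val : ℝ) < (y n).val + 1 := by linarith
        have hge : ((y n).val : ℝ) < (x n).val + 1 := by linarith
        norm_cast at hle hge
        lia
      refine ⟨?_, fun k hk => ?_⟩
      · rw [hxy] at hx
        simp only [← Nat.add_assoc]
        linarith
      · rcases Nat.lt_succ_iff_lt_or_eq.1 hk with hk | rfl
        exacts [ih.2 k hk, Fin.ext hxy]
  exact funext fun n => (htail (n + 1)).2 n n.lt_succ_self

/-- Some tail of the expansion vanishes. -/
def HasZeroTail {s : ℕ} (x : ℕ → Fin s) : Prop := ∃ n, Real.ofDigits (fun k => x (k + n)) = 0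

theorem ofDigits_tail_eq_zero {s : ℕ} {x : ℕ → Fin s} (h : Real.ofDigits x = 0) :
    Real.ofDigits (fun n => x (n + 1)) = 0 := by
  have hx := mul_ofDigits_eq x
  rw [h, mul_zero] at hx
  have := Real.ofDigits_nonneg (fun n => x (n + 1))
  have : (0 : ℝ) ≤ (x 0).val := by positivity
  linarith

theorem ofDigits_tail_eq_one {s : ℕ} {x : ℕ → Fin s} (h : Real.ofDigits x = 1) :
    Real.ofDigits (fun n => x (n + 1)) = 1 := by
  have hx := mul_ofDigits_eq x
  rw [h, mul_one] at hx
  have := Real.ofDigits_le_one (fun n => x (n + 1))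
  have : ((x 0).val : ℝ) + 1 ≤ s := by exact_mod_cast (x 0).isLt
  linarith

theorem hasZeroTail_tail_iff {s : ℕ} {x : ℕ → Fin s} :
    HasZeroTail (fun n => x (n + 1)) ↔ HasZeroTail x := by
  constructor
  · rintro ⟨n, hn⟩
    exact ⟨n + 1, hn⟩
  · rintro ⟨n, hn⟩
    refine ⟨n, ?_⟩
    have := ofDigits_tail_eq_zero hn
    simpa only [Nat.add_right_comm _ 1 n] using this

theorem not_hasZeroTail_of_ofDigits_eq_one {s : ℕ} {x : ℕ → Fin s} (h : Real.ofDigits x = 1) :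
    ¬ HasZeroTail x := by
  have hone : ∀ n, Real.ofDigits (fun k => x (k + n)) = 1 := by
    intro n
    induction n with
    | zero => simpa using h
    | succ n ih =>
      have := ofDigits_tail_eq_one ih
      simp only [Nat.add_right_comm _ 1 n] at this
      exact this
  rintro ⟨n, hn⟩
  exact zero_ne_one (hn.symm.trans (hone n))

theorem digit_zero_le_of_ofDigits_eq {s : ℕ} {x y : ℕ → Fin s}
    (h : Real.ofDigits x = Real.ofDigits y) (hz : HasZeroTail x ↔ HasZeroTail y) : y 0 ≤ x 0 := by
  by_contra! hlt
  have hlt' : ((x 0).val : ℝ) + 1 ≤ (y 0).val := by exact_mod_cast hlt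
  have hx := mul_ofDigits_eq x
  have hy := mul_ofDigits_eq y
  rw [h, hy] at hx
  have h0 := Real.ofDigits_nonneg (fun n => y (n + 1))
  have h1 := Real.ofDigits_le_one (fun n => x (n + 1))
  have hx1 : Real.ofDigits (fun n => x (n + 1)) = 1 := by linarith
  have hy0 : Real.ofDigits (fun n => y (n + 1)) = 0 := by linarith
  exact not_hasZeroTail_of_ofDigits_eq_one hx1
    (hasZeroTail_tail_iff.2 (hz.2 (hasZeroTail_tail_iff.1 ⟨0, hy0⟩)))

/-- An expansion is determined by its value and by whether it has a vanishing tail. -/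
theorem eq_of_ofDigits_eq_of_hasZeroTail_iff {s : ℕ} {x y : ℕ → Fin s}
    (h : Real.ofDigits x = Real.ofDigits y) (hz : HasZeroTail x ↔ HasZeroTail y) : x = y := by
  funext n
  induction n generalizing x y with
  | zero =>
    exact le_antisymm (digit_zero_le_of_ofDigits_eq h.symm hz.symm)
      (digit_zero_le_of_ofDigits_eq h hz)
  | succ n ih =>
    have h0 : x 0 = y 0 := le_antisymm (digit_zero_le_of_ofDigits_eq h.symm hz.symm)
      (digit_zero_le_of_ofDigits_eq h hz)
    have hx := mul_ofDigits_eq x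
    rw [h, mul_ofDigits_eq y, h0] at hx
    exact ih (x := fun n => x (n + 1)) (y := fun n => y (n + 1)) (add_left_cancel hx).symm
      (by rw [hasZeroTail_tail_iff, hasZeroTail_tail_iff, hz])

theorem muPZ_val {p m : ℕ} (hp : 0 < p) (hm : 0 < m) (a : ℤ → Fin (p * m)) (k : ℤ) :
    (muPZ (p * m) p a k).val = p * ((a k).val % m) + (a (k + 1)).val / m := by
  have hs : 0 < p * m := by positivity
  simp only [muPZ, hs, dif_pos]
  have h1 : p * (a (k + 1)).val / (p * m) = (a (k + 1)).val / m := Nat.mul_div_mul_left _ _ hp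
  have h2 : (a (k + 1)).val / m < p := Nat.div_lt_of_lt_mul ((a (k + 1)).isLt.trans_eq (mul_comm p m))
  have h3 : (a k).val % m + 1 ≤ m := Nat.mod_lt _ hm
  have h4 : p * ((a k).val % m) + (a (k + 1)).val / m < p * m := by nlinarith
  rw [h1, Nat.add_mod, Nat.mul_mod_mul_left, Nat.mod_eq_of_lt (a := (a (k + 1)).val / m)
    (h2.trans_le (Nat.le_mul_of_pos_right p hm)), Nat.mod_eq_of_lt h4]

theorem muPZ_bijective {p m : ℕ} (hp : 0 < p) (hm : 0 < m) :
    Function.Bijective (muPZ (p * m) p) := by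
  constructor
  · intro a b hab
    have hval : ∀ k, p * ((a k).val % m) + (a (k + 1)).val / m =
        p * ((b k).val % m) + (b (k + 1)).val / m := fun k => by
      rw [← muPZ_val hp hm, ← muPZ_val hp hm, hab]
    have hlt : ∀ (c : ℤ → Fin (p * m)) k, (c k).val / m < p := fun c k =>
      Nat.div_lt_of_lt_mul ((c k).isLt.trans_eq (mul_comm p m))
    have hmod : ∀ k, (a k).val % m = (b k).val % m := fun k => by
      have := congrArg (· / p) (hval k)
      simpa [Nat.mul_add_div hp, Nat.div_eq_of_lt (hlt _ _)] using this
    have hdiv : ∀ k, (a (k + 1)).val / m = (b (k + 1)).val / m := fun k => by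
      have := hval k
      rw [hmod k] at this
      exact Nat.add_left_cancel this
    funext k
    refine Fin.ext ?_
    rw [← Nat.div_add_mod (a k).val m, ← Nat.div_add_mod (b k).val m, hmod k]
    have := hdiv (k - 1)
    rw [sub_add_cancel] at this
    rw [this]
  · intro b
    have hlt : ∀ k, m * ((b (k - 1)).val % p) + (b k).val / p < p * m := fun k => by
      have h1 : (b (k - 1)).val % p + 1 ≤ p := Nat.mod_lt _ hp
      have h2 : (b k).val / p < m := Nat.div_lt_of_lt_mul (b k).isLt
      nlinarith
    refine ⟨fun k => ⟨m * ((b (k - 1)).val % p) + (b k).val / p, hlt k⟩, ?_⟩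
    funext k
    refine Fin.ext ?_
    rw [muPZ_val hp hm]
    have h2 : ∀ k, (b k).val / p < m := fun k => Nat.div_lt_of_lt_mul (b k).isLt
    simp only [add_sub_cancel_right]
    rw [Nat.mul_add_mod, Nat.mod_eq_of_lt (h2 k), Nat.mul_add_div hm, Nat.div_eq_of_lt (h2 _),
      add_zero, Nat.div_add_mod]

theorem continuous_muPZ (s p : ℕ) : Continuous (muPZ s p) := by
  refine continuous_pi fun k => ?_
  have : Continuous fun x : Fin s × Fin s => if h : 0 < s then
      (⟨(p * x.1.val + p * x.2.val / s) % s, Nat.mod_lt _ h⟩ : Fin s) else x.1 :=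
    continuous_of_discreteTopology
  exact this.comp (g := fun x : Fin s × Fin s => _) (f := fun a : ℤ → Fin s => (a k, a (k + 1)))
    ((continuous_apply k).prodMk (continuous_apply (k + 1)))

theorem isCATZ_muPZ (s p : ℕ) : IsCATZ (Fin s) (muPZ s p) :=
  ⟨continuous_muPZ s p, rfl⟩

theorem isCATZ_shiftZ (A : Type) [TopologicalSpace A] : IsCATZ A (shiftZ A) :=
  ⟨continuous_pi fun k => continuous_apply (k + 1), rfl⟩

theorem shiftZ_invShiftZ (A : Type) (a : ℤ → A) : shiftZ A (invShiftZ A a) = a := by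
  funext k; simp [shiftZ, invShiftZ]

theorem invShiftZ_shiftZ (A : Type) (a : ℤ → A) : invShiftZ A (shiftZ A a) = a := by
  funext k; simp [shiftZ, invShiftZ]

theorem isCATZ_invShiftZ (A : Type) [TopologicalSpace A] : IsCATZ A (invShiftZ A) :=
  ⟨continuous_pi fun k => continuous_apply (k - 1), by
    funext a
    simp [shiftZ_invShiftZ, invShiftZ_shiftZ]⟩

theorem shiftZ_bijective (A : Type) : Function.Bijective (shiftZ A) :=
  Function.bijective_iff_has_inverse.2 ⟨invShiftZ A, invShiftZ_shiftZ A, shiftZ_invShiftZ A⟩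

theorem invShiftZ_bijective (A : Type) : Function.Bijective (invShiftZ A) :=
  Function.bijective_iff_has_inverse.2 ⟨shiftZ A, shiftZ_invShiftZ A, invShiftZ_shiftZ A⟩

/-- The nonnegative coordinates of a two-sided sequence. -/
def rightHalf {A : Type} (a : ℤ → A) : ℕ → A := fun n => a n

theorem rightHalf_shiftZ {A : Type} (a : ℤ → A) :
    rightHalf (shiftZ A a) = fun n => rightHalf a (n + 1) := by
  funext n; simp [rightHalf, shiftZ]

/-- The point of the circle whose base `s` expansion is the right half of a sequence. -/
noncomputable def circlePoint {s : ℕ} (a : ℤ → Fin s) : UnitAddCircle :=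
  (Real.ofDigits (rightHalf a) : ℝ)

theorem continuous_circlePoint {s : ℕ} : Continuous (circlePoint (s := s)) :=
  (AddCircle.continuous_mk' 1).comp
    (Real.continuous_ofDigits.comp (continuous_pi fun n => continuous_apply (n : ℤ)))

theorem UnitAddCircle.coe_natCast (n : ℕ) : ((n : ℝ) : UnitAddCircle) = 0 := by
  rw [AddCircle.coe_eq_zero_iff]
  exact ⟨n, by simp⟩

theorem circlePoint_shiftZ {s : ℕ} (a : ℤ → Fin s) :
    circlePoint (shiftZ (Fin s) a) = s • circlePoint a := by
  rw [circlePoint, circlePoint, ← AddCircle.coe_nsmul, nsmul_eq_mul, mul_ofDigits_eq,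
    AddCircle.coe_add, UnitAddCircle.coe_natCast, zero_add, rightHalf_shiftZ]

theorem ofDigits_rightHalf_muPZ {p m : ℕ} (hp : 0 < p) (hm : 0 < m) (a : ℤ → Fin (p * m)) :
    p * Real.ofDigits (rightHalf a) =
      Real.ofDigits (rightHalf (muPZ (p * m) p a)) + ((a 0).val / m : ℕ) := by
  set s : ℝ := ((p * m : ℕ) : ℝ) with hs
  have hs0 : 0 < s := by positivity
  set g : ℕ → ℝ := fun k => ((a k).val / m : ℕ) * (s ^ k)⁻¹ with hg
  have hsum : Summable g := by
    refine Summable.of_nonneg_of_le (fun k => by positivity) (fun k => ?_)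
      ((Real.summable_ofDigitsTerm (digits := rightHalf a)).mul_left s)
    have : (((a k).val / m : ℕ) : ℝ) ≤ (a k).val := by exact_mod_cast Nat.div_le_self _ _
    calc g k ≤ (a k).val * (s ^ k)⁻¹ := mul_le_mul_of_nonneg_right this (by positivity)
      _ = s * Real.ofDigitsTerm (rightHalf a) k := by
        simp only [Real.ofDigitsTerm, rightHalf, ← hs]
        rw [pow_succ]; field_simp
  have hterm : ∀ k, p * Real.ofDigitsTerm (rightHalf a) k + g (k + 1) =
      Real.ofDigitsTerm (rightHalf (muPZ (p * m) p a)) k + g k := by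
    intro k
    have hval := muPZ_val hp hm a k
    have hdm := Nat.div_add_mod (a k).val m
    have hval' : ((muPZ (p * m) p a k).val : ℝ) =
        p * ((a k).val % m : ℕ) + ((a (k + 1)).val / m : ℕ) := by exact_mod_cast hval
    have hdm' : ((a k).val : ℝ) = m * ((a k).val / m : ℕ) + ((a k).val % m : ℕ) := by
      exact_mod_cast hdm.symm
    simp only [Real.ofDigitsTerm, rightHalf, ← hs, hg]
    rw [hval', hdm']
    push_cast
    have : s = p * m := by rw [hs]; push_cast; rfl
    rw [pow_succ]
    field_simp
    rw [this]
    ring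
  have h1 : Summable fun k => p * Real.ofDigitsTerm (rightHalf a) k :=
    Real.summable_ofDigitsTerm.mul_left _
  have h2 : Summable fun k => g (k + 1) := (summable_nat_add_iff 1).2 hsum
  have htot : ∑' k, (p * Real.ofDigitsTerm (rightHalf a) k + g (k + 1)) =
      ∑' k, (Real.ofDigitsTerm (rightHalf (muPZ (p * m) p a)) k + g k) := tsum_congr hterm
  rw [h1.tsum_add h2, Real.summable_ofDigitsTerm.tsum_add hsum, tsum_mul_left,
    hsum.tsum_eq_zero_add] at htot
  simp only [Real.ofDigits]
  have hg0 : g 0 = ((a 0).val / m : ℕ) := by simp [hg]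
  rw [hg0] at htot
  linarith

theorem circlePoint_muPZ {p m : ℕ} (hp : 0 < p) (hm : 0 < m) (a : ℤ → Fin (p * m)) :
    circlePoint (muPZ (p * m) p a) = p • circlePoint a := by
  rw [circlePoint, circlePoint, ← AddCircle.coe_nsmul, nsmul_eq_mul,
    ofDigits_rightHalf_muPZ hp hm, AddCircle.coe_add, UnitAddCircle.coe_natCast, add_zero]

theorem eq_of_coe_unitAddCircle_eq {x y : ℝ} (h : (x : UnitAddCircle) = y) (hxy : |x - y| < 1) :
    x = y := by
  rw [← sub_eq_zero, ← AddCircle.coe_sub, AddCircle.coe_eq_zero_iff] at h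
  obtain ⟨n, hn⟩ := h
  rw [zsmul_eq_mul, mul_one] at hn
  rw [← hn] at hxy
  have hn0 : n = 0 := Int.abs_lt_one_iff.1 (by exact_mod_cast hxy)
  rw [hn0, Int.cast_zero] at hn
  linarith

theorem shiftZ_iterate_apply {A : Type} (a : ℤ → A) (n : ℕ) (k : ℤ) :
    ((shiftZ A)^[n] a) k = a (k + n) := by
  induction n generalizing a with
  | zero => simp
  | succ n ih =>
    rw [Function.iterate_succ_apply, ih]
    simp [shiftZ, add_assoc]

theorem invShiftZ_iterate_apply {A : Type} (a : ℤ → A) (n : ℕ) (k : ℤ) :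
    ((invShiftZ A)^[n] a) k = a (k - n) := by
  induction n generalizing a with
  | zero => simp
  | succ n ih =>
    rw [Function.iterate_succ_apply, ih]
    simp [invShiftZ, sub_sub]

/-- A closed shift-invariant set whose circle points fill the circle is the full shift. -/
theorem eq_univ_of_circlePoint_image_eq_univ {s : ℕ} (hs : 2 ≤ s) {A : Set (ℤ → Fin s)}
    (hA : IsClosed A) (hshift : Set.MapsTo (shiftZ (Fin s)) A A)
    (himg : circlePoint '' A = Set.univ) : A = Set.univ := by
  refine Set.eq_univ_of_forall fun b => ?_
  have happrox : ∀ N : ℕ, ∃ a ∈ A, ∀ j : ℤ, -N ≤ j → j ≤ N → a j = b j := by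
    intro N
    set y : ℕ → Fin s := fun k => if k ≤ 2 * N then b (k - N) else
      ⟨k % 2, (Nat.mod_lt k two_pos).trans_le hs⟩ with hy
    have hy0 : ∀ n, ∃ k ≥ n, 0 < (y k).val := fun n =>
      ⟨2 * (n + N) + 1, by lia, by
        simp [hy, show ¬ 2 * (n + N) + 1 ≤ 2 * N by lia, Nat.add_mod]⟩
    have hy1 : ∀ n, ∃ k ≥ n, (y k).val + 1 < s := fun n =>
      ⟨2 * (n + N + 1), by lia, by
        simp only [hy, show ¬ 2 * (n + N + 1) ≤ 2 * N by lia, if_false, Nat.mul_mod_right]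
        lia⟩
    obtain ⟨k₀, -, h₀⟩ := hy0 0
    obtain ⟨k₁, -, h₁⟩ := hy1 0
    have hpos := ofDigits_pos_of_digit_pos h₀
    have hlt := ofDigits_lt_one_of_digit_lt h₁
    obtain ⟨a, haA, ha⟩ : ((Real.ofDigits y : ℝ) : UnitAddCircle) ∈ circlePoint '' A :=
      himg ▸ Set.mem_univ _
    have hval : Real.ofDigits (rightHalf a) = Real.ofDigits y := by
      refine eq_of_coe_unitAddCircle_eq ha ?_
      have := Real.ofDigits_nonneg (rightHalf a)
      have := Real.ofDigits_le_one (rightHalf a)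
      rw [abs_lt]
      constructor <;> linarith
    have hay := eq_of_ofDigits_eq hval hy0 hy1
    refine ⟨(shiftZ (Fin s))^[N] a, hshift.iterate N haA, fun j hj₁ hj₂ => ?_⟩
    obtain ⟨k, hk⟩ := Int.eq_ofNat_of_zero_le (show 0 ≤ j + N by lia)
    have hak : a k = y k := congrFun hay k
    rw [shiftZ_iterate_apply, hk]
    change a (k : ℤ) = b j
    rw [hak, hy]
    simp only [show k ≤ 2 * N by lia, if_true]
    congr 1
    change j + N = (k : ℤ) at hk
    lia
  choose a haA hab using happrox
  refine hA.mem_of_tendsto (f := a) (b := Filter.atTop) (tendsto_pi_nhds.2 fun j => ?_)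
    (Filter.Eventually.of_forall haA)
  refine tendsto_const_nhds.congr' ?_
  filter_upwards [Filter.eventually_ge_atTop j.natAbs] with N hN
  exact (hab N j (by lia) (by lia)).symm

/-- A set of two-sided sequences invariant under both shifts and having finitely many right halves
is finite. -/
theorem finite_of_finite_rightHalf {B : Type} {A : Set (ℤ → B)}
    (hshift : Set.MapsTo (shiftZ B) A A) (hinv : Set.MapsTo (invShiftZ B) A A)
    (hfin : (rightHalf '' A).Finite) : A.Finite := by
  set S : (ℕ → B) → (ℕ → B) := fun x n => x (n + 1) with hS
  have hmaps : Set.MapsTo S (rightHalf '' A) (rightHalf '' A) := by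
    rintro _ ⟨a, ha, rfl⟩
    exact ⟨shiftZ B a, hshift ha, rightHalf_shiftZ a⟩
  have hsurj : Set.SurjOn S (rightHalf '' A) (rightHalf '' A) := by
    rintro _ ⟨a, ha, rfl⟩
    refine ⟨_, ⟨invShiftZ B a, hinv ha, rfl⟩, ?_⟩
    rw [hS]
    simp only [← rightHalf_shiftZ, shiftZ_invShiftZ]
  have hinj : Set.InjOn S (rightHalf '' A) := by
    have := Finset.injOn_of_surjOn_of_card_le (s := hfin.toFinset) (t := hfin.toFinset) S
      (by simpa using hmaps) (by simpa using hsurj) le_rfl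
    simpa using this
  refine hfin.of_finite_image fun a ha b hb hab => ?_
  have hall : ∀ n : ℕ,
      rightHalf ((invShiftZ B)^[n] a) = rightHalf ((invShiftZ B)^[n] b) := by
    intro n
    induction n with
    | zero => exact hab
    | succ n ih =>
      refine hinj ⟨_, hinv.iterate (n + 1) ha, rfl⟩ ⟨_, hinv.iterate (n + 1) hb, rfl⟩ ?_
      rw [hS]
      simp only [← rightHalf_shiftZ, Function.iterate_succ_apply', shiftZ_invShiftZ]
      exact ih
  funext k
  have h := congrFun (hall k.natAbs) (k + k.natAbs).toNat
  simp only [rightHalf, invShiftZ_iterate_apply] at h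
  rwa [show ((k + k.natAbs).toNat : ℤ) - k.natAbs = k by lia] at h

/-- If the circle points of a family of sequences form a finite set, so do the right halves. -/
theorem finite_rightHalf_of_finite_circlePoint {s : ℕ} {A : Set (ℤ → Fin s)}
    (hfin : (circlePoint '' A).Finite) : (rightHalf '' A).Finite := by
  set g : (ℕ → Fin s) → UnitAddCircle × Prop × Prop := fun x =>
    ((Real.ofDigits x : ℝ), Real.ofDigits x = 1, HasZeroTail x) with hg
  have hsub : g '' (rightHalf '' A) ⊆ (circlePoint '' A) ×ˢ Set.univ := by
    rintro _ ⟨_, ⟨a, ha, rfl⟩, rfl⟩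
    exact ⟨⟨a, ha, rfl⟩, Set.mem_univ _⟩
  refine ((hfin.prod Set.finite_univ).subset hsub).of_finite_image fun x _ y _ hxy => ?_
  simp only [hg, Prod.mk.injEq, eq_iff_iff] at hxy
  obtain ⟨hc, h1, hz⟩ := hxy
  refine eq_of_ofDigits_eq_of_hasZeroTail_iff ?_ hz
  by_cases hx : Real.ofDigits x = 1
  · rw [hx, h1.1 hx]
  · have hx1 := lt_of_le_of_ne (Real.ofDigits_le_one x) hx
    have hy1 := lt_of_le_of_ne (Real.ofDigits_le_one y) (mt h1.2 hx)
    have hx0 := Real.ofDigits_nonneg x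
    have hy0 := Real.ofDigits_nonneg y
    refine eq_of_coe_unitAddCircle_eq hc ?_
    rw [abs_lt]
    constructor <;> linarith

/-- Closed proper sets invariant under `μ_p` and both shifts are finite. -/
theorem finite_of_invariant {s p : ℕ} (hs : 2 ≤ s) (hp : p.Prime) (hps : p ∣ s)
    (hpow : ¬ ∃ m : ℕ, s = p ^ m) {A : Set (ℤ → Fin s)} (hA : IsClosed A)
    (hmu : Set.MapsTo (muPZ s p) A A) (hshift : Set.MapsTo (shiftZ (Fin s)) A A)
    (hinv : Set.MapsTo (invShiftZ (Fin s)) A A) (hne : A ≠ Set.univ) : A.Finite := by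
  have hirr := irrational_log_div_log_of_not_pow hs hp hpow
  obtain ⟨m, rfl⟩ := hps
  have hm : 0 < m := Nat.pos_of_ne_zero fun h => by simp [h] at hs
  rcases finite_or_eq_univ_of_nsmul_invariant hp.one_lt hs hirr
    (hA.isCompact.image continuous_circlePoint).isClosed
    (by
      rintro _ ⟨a, ha, rfl⟩
      exact ⟨_, hmu ha, circlePoint_muPZ hp.pos hm a⟩)
    (by
      rintro _ ⟨a, ha, rfl⟩
      exact ⟨_, hshift ha, circlePoint_shiftZ a⟩) with hfin | huniv
  · exact finite_of_finite_rightHalf hshift hinv (finite_rightHalf_of_finite_circlePoint hfin)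
  · exact absurd (eq_univ_of_circlePoint_image_eq_univ hs hA hshift huniv) hne

/-- Let `p` be a prime dividing `s` with `s` not a power of `p`. Then
`⟨μ_p, σ, σ⁻¹⟩ ⊆ CAT(Λ_s^ℤ)` is an ID semigroup; consequently, if `s` is not a power of
a prime, the automorphism group `Aut(Λ_s^ℤ)` (of bijective cellular automaton
transformations of the two-sided shift) is an ID semigroup. -/
theorem muP_twoSided_ID_and_Aut_ID (s p : ℕ) (hs : 2 ≤ s) (hp : p.Prime) (hps : p ∣ s)
    (hpow : ¬ ∃ m : ℕ, s = p ^ m) :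
    HasID (gen ({muPZ s p, shiftZ (Fin s), invShiftZ (Fin s)} :
        Set ((ℤ → Fin s) → (ℤ → Fin s)))) ∧
      (¬ IsPrimePow s →
        HasID {τ : (ℤ → Fin s) → (ℤ → Fin s) | IsCATZ (Fin s) τ ∧ Function.Bijective τ}) := by
  refine ⟨fun A hA hinv hne => ?_, fun _ A hA hinv hne => ?_⟩
  · exact finite_of_invariant hs hp hps hpow hA (fun x hx => hinv _ (.base (by simp)) x hx)
      (fun x hx => hinv _ (.base (by simp)) x hx) (fun x hx => hinv _ (.base (by simp)) x hx) hne
  · refine finite_of_invariant hs hp hps hpow hA (fun x hx => hinv _ ⟨isCATZ_muPZ s p, ?_⟩ x hx)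
      (fun x hx => hinv _ ⟨isCATZ_shiftZ _, shiftZ_bijective _⟩ x hx)
      (fun x hx => hinv _ ⟨isCATZ_invShiftZ _, invShiftZ_bijective _⟩ x hx) hne
    obtain ⟨m, rfl⟩ := hps
    exact muPZ_bijective hp.pos (Nat.pos_of_ne_zero fun h => by simp [h] at hs)
end
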